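/- For every δ > 0 there exists a constant C_δ > 0 such that the following holds. Let λ ∈ ℝ, ξ ∈ ℝ, n₂, m₂ ∈ ℤ, N ≥ 1, M > 0, and define Δ(ζ) = φ(−ξ−ζ, −n₂−m₂) + φ(ζ, m₂) + φ(ξ, n₂). Let E ⊆ ℝ be any measurable set such that every ζ ∈ E satisfies: |(−ξ−ζ, −n₂−m₂)| ≤ 8N, |(ζ, m₂)| ≤ 8N, |(ξ, n₂)| ≤ 8N, the maximum of these three Euclidean norms is at least N, and |θ(−ξ−ζ, −n₂−m₂) − θ(ζ, m₂)| ≥ M. Then ∫_E (1 + |λ − Δ(ζ)|)^{−1−δ} dζ ≤ C_δ / (N·M). -/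

import Mathlib

open MeasureTheory Real

noncomputable section

/-- The Zakharov–Kuznetsov dispersion relation `φ(a,b) = a(a²+b²)`. -/
def phi (a b : ℝ) : ℝ := a * (a ^ 2 + b ^ 2)

/-- `θ(a,b) = (3a² + b²)^{1/2}`. -/
def theta (a b : ℝ) : ℝ := Real.sqrt (3 * a ^ 2 + b ^ 2)

/-- Euclidean norm of a point of `ℝ²`. -/
def nrm (x y : ℝ) : ℝ := Real.sqrt (x ^ 2 + y ^ 2)

/-- The resonance function `Δ(ζ) = φ(−ξ−ζ, −n₂−m₂) + φ(ζ, m₂) + φ(ξ, n₂)`. -/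
def Δres (ξ : ℝ) (n₂ m₂ : ℤ) (ζ : ℝ) : ℝ :=
  phi (-ξ - ζ) (-(n₂ : ℝ) - (m₂ : ℝ)) + phi ζ (m₂ : ℝ) + phi ξ (n₂ : ℝ)

/-- Change of variables for an injective function whose derivative is at least `K` in size. -/
lemma mul_lintegral_comp_le_lintegral {g g' : ℝ → ℝ} {S : Set ℝ} (hS : MeasurableSet S)
    (hg : ∀ x ∈ S, HasDerivAt g (g' x) x) (hinj : Set.InjOn g S) {K : ℝ}
    (hK : ∀ x ∈ S, K ≤ |g' x|) (f : ℝ → ENNReal) :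
    ENNReal.ofReal K * ∫⁻ x in S, f (g x) ≤ ∫⁻ y, f y := by
  calc ENNReal.ofReal K * ∫⁻ x in S, f (g x)
      = ∫⁻ x in S, ENNReal.ofReal K * f (g x) :=
        (lintegral_const_mul' _ _ ENNReal.ofReal_ne_top).symm
    _ ≤ ∫⁻ x in S, ENNReal.ofReal |g' x| * f (g x) :=
        setLIntegral_mono' hS fun x hx => by gcongr; exact hK x hx
    _ = ∫⁻ y in g '' S, f y :=
        (lintegral_image_eq_lintegral_abs_deriv_mul hS
          (fun x hx => (hg x hx).hasDerivWithinAt) hinj f).symm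
    _ ≤ ∫⁻ y, f y := setLIntegral_le_lintegral _ _

lemma theta_sq (a b : ℝ) : theta a b ^ 2 = 3 * a ^ 2 + b ^ 2 :=
  Real.sq_sqrt (by positivity)

lemma nrm_nonneg (a b : ℝ) : 0 ≤ nrm a b := Real.sqrt_nonneg _

lemma nrm_le_theta (a b : ℝ) : nrm a b ≤ theta a b :=
  Real.sqrt_le_sqrt (by nlinarith [sq_nonneg a])

lemma nrm_neg (a b : ℝ) : nrm (-a) (-b) = nrm a b := by simp [nrm]

lemma nrm_add_le (a b c d : ℝ) : nrm (a + c) (b + d) ≤ nrm a b + nrm c d := by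
  have hdot : a * c + b * d ≤ nrm a b * nrm c d := by
    rw [nrm, nrm, ← Real.sqrt_mul (by positivity)]
    exact Real.le_sqrt_of_sq_le (by nlinarith [sq_nonneg (a * d - b * c)])
  have h1 : nrm a b ^ 2 = a ^ 2 + b ^ 2 := Real.sq_sqrt (by positivity)
  have h2 : nrm c d ^ 2 = c ^ 2 + d ^ 2 := Real.sq_sqrt (by positivity)
  exact Real.sqrt_le_iff.2 ⟨add_nonneg (nrm_nonneg a b) (nrm_nonneg c d), by nlinarith⟩

/-- The derivative of the resonance function, `θ(ζ, m₂)² - θ(-ξ-ζ, -n₂-m₂)²`. -/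
def resonanceDeriv (ξ : ℝ) (n₂ m₂ : ℤ) (ζ : ℝ) : ℝ :=
  theta ζ (m₂ : ℝ) ^ 2 - theta (-ξ - ζ) (-(n₂ : ℝ) - (m₂ : ℝ)) ^ 2

lemma resonanceDeriv_eq (ξ : ℝ) (n₂ m₂ : ℤ) (ζ : ℝ) :
    resonanceDeriv ξ n₂ m₂ ζ =
      3 * ζ ^ 2 + (m₂ : ℝ) ^ 2 - (3 * (-ξ - ζ) ^ 2 + (-(n₂ : ℝ) - (m₂ : ℝ)) ^ 2) := by
  rw [resonanceDeriv, theta_sq, theta_sq]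

lemma measurable_resonanceDeriv (ξ : ℝ) (n₂ m₂ : ℤ) : Measurable (resonanceDeriv ξ n₂ m₂) := by
  rw [funext (resonanceDeriv_eq ξ n₂ m₂)]
  fun_prop

lemma hasDerivAt_Δres (ξ : ℝ) (n₂ m₂ : ℤ) (ζ : ℝ) :
    HasDerivAt (Δres ξ n₂ m₂) (resonanceDeriv ξ n₂ m₂ ζ) ζ := by
  have h1 : HasDerivAt (fun x : ℝ => -ξ - x) (-1) ζ := (hasDerivAt_id' ζ).const_sub _
  have h := ((h1.mul ((h1.pow 2).add_const ((-(n₂ : ℝ) - (m₂ : ℝ)) ^ 2))).add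
    ((hasDerivAt_id' ζ).mul (((hasDerivAt_id' ζ).pow 2).add_const ((m₂ : ℝ) ^ 2)))).add_const
      (phi ξ n₂)
  refine h.congr_deriv ?_
  rw [resonanceDeriv_eq]
  simp
  ring

/-- The resonance function is quadratic, so its increments are given by the trapezoidal rule. -/
lemma two_mul_Δres_sub (ξ : ℝ) (n₂ m₂ : ℤ) (x y : ℝ) :
    2 * (Δres ξ n₂ m₂ x - Δres ξ n₂ m₂ y) =
      (x - y) * (resonanceDeriv ξ n₂ m₂ x + resonanceDeriv ξ n₂ m₂ y) := by
  simp only [resonanceDeriv_eq, Δres, phi]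
  ring

lemma injOn_Δres {ξ : ℝ} {n₂ m₂ : ℤ} {S : Set ℝ}
    (h : ∀ x ∈ S, ∀ y ∈ S, resonanceDeriv ξ n₂ m₂ x + resonanceDeriv ξ n₂ m₂ y ≠ 0) :
    Set.InjOn (Δres ξ n₂ m₂) S := by
  intro x hx y hy hxy
  have h2 := two_mul_Δres_sub ξ n₂ m₂ x y
  rw [hxy, sub_self, mul_zero, eq_comm, mul_eq_zero] at h2
  exact sub_eq_zero.1 (h2.resolve_right (h x hx y hy))

lemma mul_le_abs_resonanceDeriv {ξ : ℝ} {n₂ m₂ : ℤ} {ζ N M : ℝ} (hM : 0 ≤ M)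
    (hN : N ≤ max (max (nrm (-ξ - ζ) (-(n₂ : ℝ) - (m₂ : ℝ))) (nrm ζ (m₂ : ℝ))) (nrm ξ (n₂ : ℝ)))
    (hθ : M ≤ |theta (-ξ - ζ) (-(n₂ : ℝ) - (m₂ : ℝ)) - theta ζ (m₂ : ℝ)|) :
    N * M ≤ |resonanceDeriv ξ n₂ m₂ ζ| := by
  have htri : nrm ξ (n₂ : ℝ) ≤ nrm (-ξ - ζ) (-(n₂ : ℝ) - (m₂ : ℝ)) + nrm ζ (m₂ : ℝ) := by
    have h := nrm_add_le (-ξ - ζ) (-(n₂ : ℝ) - (m₂ : ℝ)) ζ m₂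
    rwa [sub_add_cancel, sub_add_cancel, nrm_neg] at h
  have ha := nrm_nonneg (-ξ - ζ) (-(n₂ : ℝ) - (m₂ : ℝ))
  have hb := nrm_nonneg ζ (m₂ : ℝ)
  have hsum : N ≤ theta (-ξ - ζ) (-(n₂ : ℝ) - (m₂ : ℝ)) + theta ζ (m₂ : ℝ) :=
    calc N ≤ nrm (-ξ - ζ) (-(n₂ : ℝ) - (m₂ : ℝ)) + nrm ζ (m₂ : ℝ) :=
          hN.trans (max_le (max_le (by linarith) (by linarith)) htri)
      _ ≤ _ := add_le_add (nrm_le_theta _ _) (nrm_le_theta _ _)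
  have hnonneg : 0 ≤ theta (-ξ - ζ) (-(n₂ : ℝ) - (m₂ : ℝ)) + theta ζ (m₂ : ℝ) :=
    add_nonneg (Real.sqrt_nonneg _) (Real.sqrt_nonneg _)
  rw [resonanceDeriv, abs_sub_comm, sq_sub_sq, abs_mul, abs_of_nonneg hnonneg]
  exact mul_le_mul hsum hθ hM hnonneg

/-- If `|Δ'| ≥ K` on `E`, then `E` splits into two sets on which `Δ` is injective, so that
integrals of functions of `Δ` over `E` are controlled by `2 / K`. -/
lemma mul_lintegral_comp_Δres_le {ξ : ℝ} {n₂ m₂ : ℤ} {E : Set ℝ} (hE : MeasurableSet E) {K : ℝ}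
    (hK : 0 < K) (h : ∀ ζ ∈ E, K ≤ |resonanceDeriv ξ n₂ m₂ ζ|) (f : ℝ → ENNReal) :
    ENNReal.ofReal K * ∫⁻ ζ in E, f (Δres ξ n₂ m₂ ζ) ≤ 2 * ∫⁻ y, f y := by
  have hm := measurable_resonanceDeriv ξ n₂ m₂
  have hpos : MeasurableSet (E ∩ {ζ | K ≤ resonanceDeriv ξ n₂ m₂ ζ}) :=
    hE.inter (measurableSet_le measurable_const hm)
  have hneg : MeasurableSet (E ∩ {ζ | K ≤ -resonanceDeriv ξ n₂ m₂ ζ}) :=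
    hE.inter (measurableSet_le measurable_const hm.neg)
  have hsub : E ⊆ (E ∩ {ζ | K ≤ resonanceDeriv ξ n₂ m₂ ζ}) ∪
      (E ∩ {ζ | K ≤ -resonanceDeriv ξ n₂ m₂ ζ}) := fun ζ hζ =>
    (le_abs.1 (h ζ hζ)).imp (fun h' => ⟨hζ, h'⟩) fun h' => ⟨hζ, h'⟩
  calc ENNReal.ofReal K * ∫⁻ ζ in E, f (Δres ξ n₂ m₂ ζ)
      ≤ ENNReal.ofReal K * ((∫⁻ ζ in E ∩ {ζ | K ≤ resonanceDeriv ξ n₂ m₂ ζ}, f (Δres ξ n₂ m₂ ζ)) +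
          ∫⁻ ζ in E ∩ {ζ | K ≤ -resonanceDeriv ξ n₂ m₂ ζ}, f (Δres ξ n₂ m₂ ζ)) :=
        mul_le_mul' le_rfl ((lintegral_mono_set hsub).trans (lintegral_union_le _ _ _))
    _ ≤ (∫⁻ y, f y) + ∫⁻ y, f y := by
        rw [mul_add]
        refine add_le_add
          (mul_lintegral_comp_le_lintegral hpos (fun x _ => hasDerivAt_Δres ξ n₂ m₂ x)
            (injOn_Δres fun x hx y hy => ?_) (fun x hx => h x hx.1) f)
          (mul_lintegral_comp_le_lintegral hneg (fun x _ => hasDerivAt_Δres ξ n₂ m₂ x)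
            (injOn_Δres fun x hx y hy => ?_) (fun x hx => h x hx.1) f)
        · have hx' : K ≤ _ := hx.2
          have hy' : K ≤ _ := hy.2
          exact ne_of_gt (by linarith)
        · have hx' : K ≤ _ := hx.2
          have hy' : K ≤ _ := hy.2
          exact ne_of_lt (by linarith)
    _ = 2 * ∫⁻ y, f y := (two_mul _).symm

/-- Level-set integral bound: on a set where the frequencies are of size at most `8N` (with the
largest at least `N`) and `|θ₁ − θ₂| ≥ M`, one has
`∫_E ⟨λ − Δ⟩^{−1−δ} dζ ≲_δ 1/(NM)`, uniformly in `λ`. -/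
theorem ZK_levelset_integral_bound (δ : ℝ) (hδ : 0 < δ) :
    ∃ C : ℝ, 0 < C ∧
      ∀ (lam ξ : ℝ) (n₂ m₂ : ℤ) (N M : ℝ), 1 ≤ N → 0 < M →
      ∀ E : Set ℝ, MeasurableSet E →
        (∀ ζ ∈ E,
          nrm (-ξ - ζ) (-(n₂ : ℝ) - (m₂ : ℝ)) ≤ 8 * N ∧
          nrm ζ (m₂ : ℝ) ≤ 8 * N ∧
          nrm ξ (n₂ : ℝ) ≤ 8 * N ∧
          N ≤ max (max (nrm (-ξ - ζ) (-(n₂ : ℝ) - (m₂ : ℝ))) (nrm ζ (m₂ : ℝ))) (nrm ξ (n₂ : ℝ)) ∧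
          M ≤ |theta (-ξ - ζ) (-(n₂ : ℝ) - (m₂ : ℝ)) - theta ζ (m₂ : ℝ)|) →
        ∫⁻ ζ in E, ENNReal.ofReal ((1 + |lam - Δres ξ n₂ m₂ ζ|) ^ (-(1 + δ))) ≤
          ENNReal.ofReal (C / (N * M)) := by
  have hintegrable : Integrable fun y : ℝ => (1 + ‖y‖) ^ (-(1 + δ)) :=
    integrable_one_add_norm (by simpa using hδ)
  have hI0 : 0 ≤ ∫ y : ℝ, (1 + ‖y‖) ^ (-(1 + δ)) :=
    integral_nonneg fun y => by positivity
  refine ⟨2 * (∫ y : ℝ, (1 + ‖y‖) ^ (-(1 + δ))) + 1, by linarith, ?_⟩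
  intro lam ξ n₂ m₂ N M hN hM E hE h
  have hNM : 0 < N * M := by positivity
  have key := mul_lintegral_comp_Δres_le hE hNM
    (fun ζ hζ => mul_le_abs_resonanceDeriv hM.le (h ζ hζ).2.2.2.1 (h ζ hζ).2.2.2.2)
    fun y => ENNReal.ofReal ((1 + |lam - y|) ^ (-(1 + δ)))
  have hshift : ∫⁻ y, ENNReal.ofReal ((1 + |lam - y|) ^ (-(1 + δ))) =
      ENNReal.ofReal (∫ y : ℝ, (1 + ‖y‖) ^ (-(1 + δ))) := by
    rw [ofReal_integral_eq_lintegral_ofReal hintegrable (ae_of_all _ fun y => by positivity)]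
    exact lintegral_sub_left_eq_self (fun y : ℝ => ENNReal.ofReal ((1 + ‖y‖) ^ (-(1 + δ)))) lam
  rw [ENNReal.ofReal_div_of_pos hNM,
    ENNReal.le_div_iff_mul_le (Or.inl (ENNReal.ofReal_pos.2 hNM).ne')
      (Or.inl ENNReal.ofReal_ne_top), mul_comm]
  refine key.trans ?_
  rw [hshift, ← ENNReal.ofReal_ofNat 2, ← ENNReal.ofReal_mul (by norm_num)]
  exact ENNReal.ofReal_le_ofReal (by linarith)

end
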